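/- Let H₁ and H₂ be real Hilbert spaces, R : H₁ → H₂ a bounded linear operator with adjoint R*, and y ∈ H₂. If y lies in the closure of the range of R but not in the range of R, then the norms of the Tikhonov regularized solutions blow up: ‖ψ_α‖ → +∞ as α → 0⁺, where ψ_α := (αI + R*R)⁻¹ R* y. -/

import Mathlib

open Topology Filter

/-- The Tikhonov regularized solution `ψ_α = (α I + R* R)⁻¹ R* y`. -/
noncomputable def tikhonov
    {H₁ H₂ : Type*} [NormedAddCommGroup H₁] [InnerProductSpace ℝ H₁] [CompleteSpace H₁]
    [NormedAddCommGroup H₂] [InnerProductSpace ℝ H₂] [CompleteSpace H₂]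
    (R : H₁ →L[ℝ] H₂) (α : ℝ) (y : H₂) : H₁ :=
  Ring.inverse (α • (1 : H₁ →L[ℝ] H₁) + (ContinuousLinearMap.adjoint R).comp R)
    ((ContinuousLinearMap.adjoint R) y)

section Resolvent

variable {H₁ H₂ : Type*} [NormedAddCommGroup H₁] [InnerProductSpace ℝ H₁] [CompleteSpace H₁]
  [NormedAddCommGroup H₂] [InnerProductSpace ℝ H₂] [CompleteSpace H₂]

open ContinuousLinearMap

theorem isUnit_smul_one_add_adjoint_comp_self (R : H₁ →L[ℝ] H₂) {α : ℝ} (hα : 0 < α) :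
    IsUnit (α • (1 : H₁ →L[ℝ] H₁) + (adjoint R).comp R) := by
  refine isUnit_of_forall_le_norm_inner_map _ (c := ⟨α, hα.le⟩) hα fun x => ?_
  refine le_trans ?_ (le_abs_self _)
  simp only [add_apply, smul_apply, one_apply_eq_self, comp_apply, inner_add_left, real_inner_smul_left,
    adjoint_inner_left, real_inner_self_eq_norm_sq]
  change ‖x‖ ^ 2 * α ≤ _
  linarith [sq_nonneg ‖R x‖]

/-- The normal equation satisfied by the Tikhonov regularized solution. -/
theorem smul_tikhonov_add_adjoint_apply (R : H₁ →L[ℝ] H₂) {α : ℝ} (hα : 0 < α) (y : H₂) :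
    α • tikhonov R α y + adjoint R (R (tikhonov R α y)) = adjoint R y :=
  DFunLike.congr_fun
    (Ring.mul_inverse_cancel _ (isUnit_smul_one_add_adjoint_comp_self R hα)) (adjoint R y)

theorem norm_tikhonov_sub_sq_le (R : H₁ →L[ℝ] H₂) (y : H₂) {α β : ℝ} (hα : 0 < α) (hαβ : α ≤ β) :
    ‖tikhonov R α y - tikhonov R β y‖ ^ 2 ≤ ‖tikhonov R α y‖ ^ 2 - ‖tikhonov R β y‖ ^ 2 := by
  obtain rfl | hlt := hαβ.eq_or_lt
  · simp
  have hu := smul_tikhonov_add_adjoint_apply R hα y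
  have hv := smul_tikhonov_add_adjoint_apply R (hα.trans hlt) y
  generalize tikhonov R α y = u at hu ⊢
  generalize tikhonov R β y = v at hv ⊢
  obtain ⟨d, rfl⟩ : ∃ d, u = v + d := ⟨u - v, by abel⟩
  have hd : α • d + adjoint R (R d) = (β - α) • v := by
    rw [← hv] at hu
    simp only [map_add, smul_add] at hu
    rw [sub_smul, ← sub_eq_zero, ← sub_eq_zero.mpr hu]
    abel
  have hinner : α * ‖d‖ ^ 2 + ‖R d‖ ^ 2 = (β - α) * inner ℝ v d := by
    simpa [inner_add_left, real_inner_smul_left, adjoint_inner_left] using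
      congrArg (fun x => inner ℝ x d) hd
  have hnonneg : 0 ≤ inner ℝ v d :=
    nonneg_of_mul_nonneg_right (hinner ▸ by positivity) (sub_pos.mpr hlt)
  rw [add_sub_cancel_left, norm_add_sq_real]
  linarith

theorem apply_eq_of_adjoint_apply_eq {R : H₁ →L[ℝ] H₂} {x : H₁} {y : H₂}
    (hy : y ∈ closure (Set.range R)) (h : adjoint R (R x) = adjoint R y) : R x = y := by
  have hclosed : IsClosed {z : H₂ | inner ℝ (R x - y) z = 0} :=
    isClosed_eq (by fun_prop) continuous_const
  have hsub : Set.range R ⊆ {z : H₂ | inner ℝ (R x - y) z = 0} := by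
    rintro _ ⟨w, rfl⟩
    rw [Set.mem_ofPred_eq, ← adjoint_inner_left, map_sub, h, sub_self, inner_zero_left]
  have hRx : inner ℝ (R x - y) (R x) = 0 := hsub ⟨x, rfl⟩
  have hzero : inner ℝ (R x - y) (R x - y) = 0 := by
    rw [inner_sub_right, hRx, closure_minimal hsub hclosed hy, sub_zero]
  exact sub_eq_zero.mp (inner_self_eq_zero.mp hzero)

theorem exists_tendsto_tikhonov_of_norm_le {R : H₁ →L[ℝ] H₂} {y : H₂} {M : ℝ}
    (hM : ∀ α > 0, ‖tikhonov R α y‖ ≤ M) :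
    ∃ x, Tendsto (fun n : ℕ => tikhonov R (1 / ((n : ℝ) + 1)) y) atTop (𝓝 x) := by
  set u : ℕ → H₁ := fun n => tikhonov R (1 / ((n : ℝ) + 1)) y
  have hu {m n : ℕ} (hmn : m ≤ n) : ‖u n - u m‖ ^ 2 ≤ ‖u n‖ ^ 2 - ‖u m‖ ^ 2 :=
    norm_tikhonov_sub_sq_le R y Nat.one_div_pos_of_nat (Nat.one_div_le_one_div hmn)
  have hmono : Monotone fun n => ‖u n‖ ^ 2 := fun m n hmn =>
    sub_nonneg.mp ((sq_nonneg _).trans (hu hmn))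
  have hbdd : BddAbove (Set.range fun n => ‖u n‖ ^ 2) := by
    refine ⟨M ^ 2, ?_⟩
    rintro _ ⟨n, rfl⟩
    exact pow_le_pow_left₀ (norm_nonneg _) (hM _ Nat.one_div_pos_of_nat) 2
  have hcauchy := (tendsto_atTop_ciSup hmono hbdd).cauchySeq
  refine cauchySeq_tendsto_of_complete (Metric.cauchySeq_iff'.mpr fun ε hε => ?_)
  obtain ⟨N, hN⟩ := Metric.cauchySeq_iff'.mp hcauchy (ε ^ 2) (by positivity)
  refine ⟨N, fun n hn => ?_⟩
  rw [dist_eq_norm]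
  refine lt_of_pow_lt_pow_left₀ 2 hε.le ?_
  exact (hu hn).trans_lt ((le_abs_self _).trans_lt (hN n hn))

theorem mem_range_of_norm_tikhonov_le {R : H₁ →L[ℝ] H₂} {y : H₂} {M : ℝ}
    (hy : y ∈ closure (Set.range R)) (hM : ∀ α > 0, ‖tikhonov R α y‖ ≤ M) :
    y ∈ Set.range R := by
  obtain ⟨x, hx⟩ := exists_tendsto_tikhonov_of_norm_le hM
  refine ⟨x, apply_eq_of_adjoint_apply_eq hy ?_⟩
  have hlim := (tendsto_one_div_add_atTop_nhds_zero_nat (𝕜 := ℝ)).smul hx |>.add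
    ((((adjoint R).comp R).continuous.tendsto x).comp hx)
  rw [zero_smul, zero_add] at hlim
  refine tendsto_nhds_unique hlim (tendsto_const_nhds.congr fun n => ?_)
  exact (smul_tikhonov_add_adjoint_apply R Nat.one_div_pos_of_nat y).symm

end Resolvent

/-- If `y` lies in the closure of the range of `R` but not in the range of `R`, then the
norms of the Tikhonov regularized solutions blow up: `‖ψ_α‖ → +∞` as `α → 0⁺`. -/
theorem tikhonov_norm_tendsto_atTop
    {H₁ H₂ : Type*} [NormedAddCommGroup H₁] [InnerProductSpace ℝ H₁] [CompleteSpace H₁]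
    [NormedAddCommGroup H₂] [InnerProductSpace ℝ H₂] [CompleteSpace H₂]
    (R : H₁ →L[ℝ] H₂) (y : H₂) (hy : y ∈ closure (Set.range R)) (hy' : y ∉ Set.range R) :
    Tendsto (fun α : ℝ => ‖tikhonov R α y‖) (𝓝[>] 0) atTop := by
  by_contra hdiv
  obtain ⟨M, hM⟩ := not_forall.mp (mt tendsto_atTop.mpr hdiv)
  refine hy' (mem_range_of_norm_tikhonov_le (M := M) hy fun β hβ => ?_)
  obtain ⟨α, hαM, hα, hαβ⟩ :=
    ((not_eventually.mp hM).and_eventually (Ioo_mem_nhdsGT hβ)).exists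
  have hle := (sq_nonneg _).trans (norm_tikhonov_sub_sq_le R y hα hαβ.le)
  exact (le_of_sq_le_sq (sub_nonneg.mp hle) (norm_nonneg _)).trans (not_le.mp hαM).le
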